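/- arXiv:2603.12159 — 2 statements merged into one kernel-verified Lean document; each statement's English description precedes it below -/
import Mathlib

section
/- Let p be a prime, χ a non-principal Dirichlet character (mod p), K ∈ Z and x ∈ (0,1). Writing z = e_p(K+x), one has the identity g_{χ,K}(x) := i·f_χ(z)/((z^p − 1)·τ(χ)) = (i/p)·Σ_{|j| < p/2} conj(χ)(K − j)/(e_p(j + x) − 1), where the sum runs over integers j with |j| < p/2. -/
open scoped BigOperators Classical

noncomputable section

/-- `e_p(x) = e^{2πix/p}`. -/
def ep (p : ℕ) (x : ℝ) : ℂ := Complex.exp (2 * Real.pi * Complex.I * x / p)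

/-- The generating polynomial `f_χ(z) = ∑_{n=0}^{p-1} χ(n) zⁿ`. -/
def fchi {p : ℕ} (χ : DirichletCharacter ℂ p) (z : ℂ) : ℂ :=
  ∑ n ∈ Finset.range p, χ (n : ZMod p) * z ^ n

/-- The Gauss sum `τ(χ) = ∑_{n=1}^{p} χ(n) e_p(n)`. -/
def tauchi {p : ℕ} (χ : DirichletCharacter ℂ p) : ℂ :=
  ∑ n ∈ Finset.Icc 1 p, χ (n : ZMod p) * ep p n

/-- The integers `j` with `|j| < p/2`. -/
def Jhalf (p : ℕ) : Finset ℤ := (Finset.Icc (-(p:ℤ)) (p:ℤ)).filter (fun j => 2 * |j| < (p:ℤ))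

lemma ep_add (p : ℕ) (x y : ℝ) : ep p (x + y) = ep p x * ep p y := by
  simp only [ep, ← Complex.exp_add]
  congr 1
  push_cast
  ring

lemma ep_intCast (p : ℕ) [NeZero p] (j : ℤ) :
    ep p (j : ℝ) = ZMod.stdAddChar (j : ZMod p) := by
  rw [ZMod.stdAddChar_coe, ep]
  push_cast
  rfl

lemma ep_pow_self (p : ℕ) [NeZero p] (x : ℝ) :
    ep p x ^ p = Complex.exp (2 * Real.pi * Complex.I * x) := by
  have hp : (p : ℂ) ≠ 0 := Nat.cast_ne_zero.2 (NeZero.ne p)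
  rw [ep, ← Complex.exp_nat_mul]
  congr 1
  field_simp

lemma ep_intCast_add_pow_self (p : ℕ) [NeZero p] (j : ℤ) (x : ℝ) :
    ep p ((j : ℝ) + x) ^ p = ep p x ^ p := by
  simp only [ep_pow_self]
  rw [Complex.exp_eq_exp_iff_exists_int]
  exact ⟨j, by push_cast; ring⟩

lemma ep_pow_self_ne_one (p : ℕ) [NeZero p] {x : ℝ} (hx : x ∈ Set.Ioo (0 : ℝ) 1) :
    ep p x ^ p ≠ 1 := by
  rw [ep_pow_self, Ne, Complex.exp_eq_one_iff]
  rintro ⟨n, hn⟩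
  have hn' : (x : ℂ) = n := by
    apply mul_left_cancel₀ Complex.two_pi_I_ne_zero
    rw [hn, mul_comm]
  have hxn : x = n := by exact_mod_cast hn'
  rw [hxn] at hx
  have h0 : 0 < n := by exact_mod_cast hx.1
  have h1 : n < 1 := by exact_mod_cast hx.2
  omega

lemma sum_zmod_eq_sum_range {M : Type*} [AddCommMonoid M] (p : ℕ) [NeZero p] (f : ZMod p → M) :
    ∑ a, f a = ∑ n ∈ Finset.range p, f n := by
  refine Finset.sum_bij' (fun a _ => a.val) (fun n _ => (n : ZMod p)) ?_ ?_ ?_ ?_ ?_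
  · exact fun a _ => Finset.mem_range.2 a.val_lt
  · exact fun _ _ => Finset.mem_univ _
  · exact fun a _ => ZMod.natCast_zmod_val a
  · exact fun n hn => ZMod.val_cast_of_lt (Finset.mem_range.1 hn)
  · exact fun a _ => by rw [ZMod.natCast_zmod_val]

lemma sum_Jhalf {M : Type*} [AddCommMonoid M] {p : ℕ} [NeZero p] (hp : Odd p) (f : ZMod p → M) :
    ∑ j ∈ Jhalf p, f j = ∑ a, f a := by
  obtain ⟨k, hk⟩ := hp
  refine Finset.sum_bij' (fun j _ => (j : ZMod p)) (fun a _ => a.valMinAbs) ?_ ?_ ?_ ?_ ?_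
  · exact fun _ _ => Finset.mem_univ _
  · intro a _
    have h := a.valMinAbs_mem_Ioc
    rw [Set.mem_Ioc] at h
    simp only [Jhalf, Finset.mem_filter, Finset.mem_Icc]
    rcases abs_cases a.valMinAbs with h' | h' <;> omega
  · intro j hj
    simp only [Jhalf, Finset.mem_filter, Finset.mem_Icc] at hj
    rw [ZMod.valMinAbs_spec]
    refine ⟨rfl, ?_⟩
    rw [Set.mem_Ioc]
    rcases abs_cases j with h' | h' <;> omega
  · exact fun a _ => a.coe_valMinAbs
  · exact fun _ _ => rfl

lemma tauchi_eq_gaussSum {p : ℕ} [NeZero p] (χ : DirichletCharacter ℂ p) :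
    tauchi χ = gaussSum χ ZMod.stdAddChar := by
  have h : ∀ n : ℕ, χ (n : ZMod p) * ep p n =
      χ (n : ZMod p) * ZMod.stdAddChar (n : ZMod p) := fun n => by
    have := ep_intCast p n
    push_cast at this
    rw [this]
  rw [tauchi, gaussSum, sum_zmod_eq_sum_range, Finset.sum_congr rfl fun n _ => h n,
    ← Finset.Ico_add_one_right_eq_Icc, Finset.sum_Ico_eq_sum_range]
  have := Finset.sum_range_succ' (fun n : ℕ => χ (n : ZMod p) * ZMod.stdAddChar (n : ZMod p)) p
  rw [Finset.sum_range_succ] at this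
  simpa [add_comm] using this.symm

/-- Fourier inversion for a non-principal character modulo a prime. -/
lemma tauchi_mul_sum_inv {p : ℕ} [Fact p.Prime] {χ : DirichletCharacter ℂ p} (hχ : χ ≠ 1)
    (n : ZMod p) :
    tauchi χ * ∑ a, χ⁻¹ a * ZMod.stdAddChar (-(n * a)) = p * χ n := by
  have hprim : χ⁻¹.IsPrimitive := by
    rw [DirichletCharacter.isPrimitive_def]
    refine ((Fact.out : p.Prime).eq_one_or_self_of_dvd _
      (DirichletCharacter.conductor_dvd_level _)).resolve_left fun h => hχ ?_
    exact inv_eq_one.1 ((DirichletCharacter.eq_one_iff_conductor_eq_one).2 h)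
  have hshift := gaussSum_mulShift_of_isPrimitive (ZMod.stdAddChar (N := p))⁻¹ hprim n
  have hcard := gaussSum_mul_gaussSum_eq_card hχ (ZMod.isPrimitive_stdAddChar p)
  rw [ZMod.card, ← tauchi_eq_gaussSum] at hcard
  have hsum : ∑ a, χ⁻¹ a * ZMod.stdAddChar (-(n * a)) =
      gaussSum χ⁻¹ ((ZMod.stdAddChar (N := p))⁻¹.mulShift n) := by
    simp only [gaussSum, AddChar.mulShift_apply, AddChar.inv_apply]
  rw [hsum, hshift, inv_inv, mul_left_comm, hcard, mul_comm]

lemma tauchi_ne_zero {p : ℕ} [Fact p.Prime] {χ : DirichletCharacter ℂ p} (hχ : χ ≠ 1) :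
    tauchi χ ≠ 0 := by
  intro h
  have h1 := tauchi_mul_sum_inv hχ 1
  rw [h, zero_mul, map_one, mul_one] at h1
  exact (Fact.out : p.Prime).ne_zero (by exact_mod_cast h1.symm)

lemma odd_of_dirichletCharacter_ne_one {p : ℕ} [hp : Fact p.Prime] {χ : DirichletCharacter ℂ p}
    (hχ : χ ≠ 1) : Odd p := by
  rcases hp.out.eq_two_or_odd' with rfl | h
  · refine absurd (MulChar.ext fun u => ?_) hχ
    rw [Subsingleton.elim u 1]
    simp
  · exact h

/-- Partial fraction expansion of `f_χ(z) / (z ^ p - 1)`. -/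
lemma mul_fchi_eq {p : ℕ} [Fact p.Prime] {χ : DirichletCharacter ℂ p} (hχ : χ ≠ 1) {z : ℂ}
    (hz : z ^ p ≠ 1) :
    p * fchi χ z =
      tauchi χ * ((z ^ p - 1) * ∑ a, χ⁻¹ a / (ZMod.stdAddChar (-a) * z - 1)) := by
  have hgeom (a : ZMod p) : ∑ n ∈ Finset.range p, ZMod.stdAddChar (-((n : ZMod p) * a)) * z ^ n =
      (z ^ p - 1) / (ZMod.stdAddChar (-a) * z - 1) := by
    have hpow : (ZMod.stdAddChar (-a) * z) ^ p = z ^ p := by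
      rw [mul_pow, ← AddChar.map_nsmul_eq_pow]
      simp
    have hne : ZMod.stdAddChar (-a) * z ≠ 1 := fun h => hz (by rw [← hpow, h, one_pow])
    rw [← hpow, ← geom_sum_eq hne]
    refine Finset.sum_congr rfl fun n _ => ?_
    rw [mul_pow, ← AddChar.map_nsmul_eq_pow, nsmul_eq_mul, mul_neg]
  calc p * fchi χ z
      = ∑ n ∈ Finset.range p, tauchi χ *
          (∑ a, χ⁻¹ a * ZMod.stdAddChar (-((n : ZMod p) * a))) * z ^ n := by
        simp only [tauchi_mul_sum_inv hχ, fchi, Finset.mul_sum, mul_assoc]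
    _ = tauchi χ * ∑ a, χ⁻¹ a *
          ∑ n ∈ Finset.range p, ZMod.stdAddChar (-((n : ZMod p) * a)) * z ^ n := by
        simp only [Finset.mul_sum, Finset.sum_mul, mul_assoc]
        exact Finset.sum_comm
    _ = _ := by
        simp only [hgeom, Finset.mul_sum]
        refine Finset.sum_congr rfl fun a _ => ?_
        ring

/-- Lemma 2.2: for `p` prime, `χ` a non-principal Dirichlet character mod `p`,
`K ∈ ℤ`, `x ∈ (0,1)` and `z = e_p(K+x)`, one has
`g_{χ,K}(x) = i f_χ(z)/((z^p − 1)τ(χ)) = (i/p) ∑_{|j|<p/2} conj(χ)(K−j)/(e_p(j+x)−1)`. -/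
theorem g_auxiliary_formula :
    ∀ (p : ℕ) [Fact p.Prime], ∀ χ : DirichletCharacter ℂ p, χ ≠ 1 →
      ∀ K : ℤ, ∀ x ∈ Set.Ioo (0:ℝ) 1,
        Complex.I * fchi χ (ep p ((K : ℝ) + x)) /
            (((ep p ((K : ℝ) + x)) ^ p - 1) * tauchi χ)
          = Complex.I / p * ∑ j ∈ Jhalf p,
              (starRingEnd ℂ) (χ ((K - j : ℤ) : ZMod p)) / (ep p ((j : ℝ) + x) - 1) := by
  intro p _ χ hχ K x hx
  have hp : (p : ℂ) ≠ 0 := Nat.cast_ne_zero.2 (NeZero.ne p)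
  have hz : ep p ((K : ℝ) + x) ^ p ≠ 1 := by
    rw [ep_intCast_add_pow_self]
    exact ep_pow_self_ne_one p hx
  have hsum : ∑ j ∈ Jhalf p, (starRingEnd ℂ) (χ ((K - j : ℤ) : ZMod p)) /
        (ep p ((j : ℝ) + x) - 1) =
      ∑ a, χ⁻¹ a / (ZMod.stdAddChar (-a) * ep p ((K : ℝ) + x) - 1) := by
    rw [← (Equiv.subLeft (K : ZMod p)).sum_comp,
      ← sum_Jhalf (odd_of_dirichletCharacter_ne_one hχ)]
    refine Finset.sum_congr rfl fun j _ => ?_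
    rw [Equiv.subLeft_apply, ep_add, ep_add, ep_intCast, ep_intCast, ← mul_assoc,
      ← AddChar.map_add_eq_mul, starRingEnd_apply, MulChar.star_apply']
    simp
  have hmain := mul_fchi_eq hχ hz
  rw [← hsum] at hmain
  have hτ := tauchi_ne_zero hχ
  have hz' := sub_ne_zero.2 hz
  rw [div_mul_eq_mul_div, div_eq_div_iff (mul_ne_zero hz' hτ) hp]
  linear_combination Complex.I * hmain

end
end

section
/- Let p be a large prime, d an even integer ≥ 2, and χ a Dirichlet character (mod p) of order d. For all real s with 2 ≤ s ≤ (log p)/(log log log p): log E( exp( 2s·Re(G_{X,χ}) ) ) = (2s/π)·log s + C_d·s + O(log s), where C_d = (2/π)( γ + log(4/π) + ∫₁^∞ (α_d(u) − u)/u² du ) + (2/π)·∫₀¹ α_d(u)/u² du and γ is the Euler–Mascheroni constant. -/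
open scoped BigOperators Classical

noncomputable section

/-- The probabilistic model `G_{X,χ}`: the random variables `X(j)`, `|j| < p/2`, are
i.i.d. uniform on the `d`-th roots of unity; an outcome is a function
`ω : {j // j ∈ Jhalf p} → Fin d`, the value `X(j)` being `e^{2πi ω(j)/d}`. -/
def GX (p d : ℕ) (ω : {j : ℤ // j ∈ Jhalf p} → Fin d) : ℂ :=
  Complex.I / p * ∑ j : {j : ℤ // j ∈ Jhalf p},
    Complex.exp (2 * Real.pi * Complex.I * ((ω j : ℕ) : ℝ) / d) /
      (ep p (((j : ℤ) : ℝ) + 1/2) - 1)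

/-- Expectation (of a real-valued functional) with respect to the uniform probability
measure on the (finite) sample space of the i.i.d. uniform family `(X(j))`. -/
def expectR {ι : Type} [Fintype ι] [DecidableEq ι] {d : ℕ} (F : (ι → Fin d) → ℝ) : ℝ :=
  (∑ ω : ι → Fin d, F ω) / (Fintype.card (ι → Fin d) : ℝ)

/-- `α_d(u) = log((1/d) ∑_{k=0}^{d-1} exp(u cos(2kπ/d)))`. -/
def alphad (d : ℕ) (u : ℝ) : ℝ :=
  Real.log ((1 / d : ℝ) * ∑ k ∈ Finset.range d, Real.exp (u * Real.cos (2 * k * Real.pi / d)))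

/-- The constant `C_d` of Proposition 5.3. -/
def Cd (d : ℕ) : ℝ :=
  2 / Real.pi * (Real.eulerMascheroniConstant + Real.log (4 / Real.pi)
      + ∫ u in Set.Ioi (1:ℝ), (alphad d u - u) / u ^ 2)
    + 2 / Real.pi * ∫ u in (0:ℝ)..1, alphad d u / u ^ 2

/-- Logarithm of the mean of `exp (c cos x + b sin x)` over the angles `x = 2πk/d`. -/
def logTrigMGF (d : ℕ) (c b : ℝ) : ℝ :=
  Real.log ((1 / d : ℝ) * ∑ k ∈ Finset.range d,
    Real.exp (c * Real.cos (2 * k * Real.pi / d) + b * Real.sin (2 * k * Real.pi / d)))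

lemma logTrigMGF_zero_right (d : ℕ) (u : ℝ) : logTrigMGF d u 0 = alphad d u := by
  simp [logTrigMGF, alphad]

lemma trigMean_pos {d : ℕ} (hd : 0 < d) (c b : ℝ) :
    0 < (1 / d : ℝ) * ∑ k ∈ Finset.range d,
      Real.exp (c * Real.cos (2 * k * Real.pi / d) + b * Real.sin (2 * k * Real.pi / d)) := by
  have h : (Finset.range d).Nonempty := Finset.nonempty_range_iff.2 hd.ne'
  have : (0 : ℝ) < d := by exact_mod_cast hd
  have := Finset.sum_pos (fun k (_ : k ∈ Finset.range d) => Real.exp_pos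
    (c * Real.cos (2 * k * Real.pi / d) + b * Real.sin (2 * k * Real.pi / d))) h
  positivity

lemma trigMean_eq_mean_cosh {e : ℕ} (he : 0 < e) (c b : ℝ) :
    (1 / (e + e : ℕ) : ℝ) * ∑ k ∈ Finset.range (e + e),
      Real.exp (c * Real.cos (2 * k * Real.pi / (e + e : ℕ)) +
        b * Real.sin (2 * k * Real.pi / (e + e : ℕ))) =
    (1 / e : ℝ) * ∑ k ∈ Finset.range e,
      Real.cosh (c * Real.cos (2 * k * Real.pi / (e + e : ℕ)) +
        b * Real.sin (2 * k * Real.pi / (e + e : ℕ))) := by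
  have he' : (e : ℝ) ≠ 0 := by exact_mod_cast he.ne'
  have hsum : ∑ k ∈ Finset.range (e + e),
      Real.exp (c * Real.cos (2 * k * Real.pi / (e + e : ℕ)) +
        b * Real.sin (2 * k * Real.pi / (e + e : ℕ))) = 2 * ∑ k ∈ Finset.range e,
      Real.cosh (c * Real.cos (2 * k * Real.pi / (e + e : ℕ)) +
        b * Real.sin (2 * k * Real.pi / (e + e : ℕ))) := by
    rw [Finset.sum_range_add, ← Finset.sum_add_distrib, Finset.mul_sum]
    refine Finset.sum_congr rfl fun k _ => ?_
    have hx : 2 * ((e + k : ℕ) : ℝ) * Real.pi / (e + e : ℕ)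
        = 2 * k * Real.pi / (e + e : ℕ) + Real.pi := by
      push_cast
      field_simp
      ring
    rw [hx, Real.cos_add_pi, Real.sin_add_pi, Real.cosh_eq]
    rw [show c * -Real.cos (2 * k * Real.pi / (e + e : ℕ)) +
        b * -Real.sin (2 * k * Real.pi / (e + e : ℕ)) = -(c * Real.cos (2 * k * Real.pi /
        (e + e : ℕ)) + b * Real.sin (2 * k * Real.pi / (e + e : ℕ))) by ring]
    ring
  rw [hsum, ← mul_assoc]
  congr 1
  push_cast
  field_simp
  ring

lemma logTrigMGF_neg_neg {d : ℕ} (hd : 0 < d) (hev : Even d) (c b : ℝ) :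
    logTrigMGF d (-c) (-b) = logTrigMGF d c b := by
  obtain ⟨e, rfl⟩ := hev
  have he : 0 < e := by omega
  unfold logTrigMGF
  rw [trigMean_eq_mean_cosh he, trigMean_eq_mean_cosh he]
  congr 2
  refine Finset.sum_congr rfl fun k _ => ?_
  rw [← Real.cosh_neg]
  congr 1
  ring

lemma mean_le_of_le {e : ℕ} (he : 0 < e) {f : ℕ → ℝ} {B : ℝ} (h : ∀ k, f k ≤ B) :
    (1 / e : ℝ) * ∑ k ∈ Finset.range e, f k ≤ B := by
  have he' : (0 : ℝ) < e := by exact_mod_cast he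
  have := Finset.sum_le_sum (fun k (_ : k ∈ Finset.range e) => h k)
  simp only [Finset.sum_const, Finset.card_range, nsmul_eq_mul] at this
  rw [one_div, inv_mul_le_iff₀ he']
  exact this

lemma le_mean_of_le {e : ℕ} (he : 0 < e) {f : ℕ → ℝ} {B : ℝ} (h : ∀ k, B ≤ f k) :
    B ≤ (1 / e : ℝ) * ∑ k ∈ Finset.range e, f k := by
  have := mean_le_of_le he (f := fun k => - f k) (B := -B) (fun k => neg_le_neg (h k))
  rw [Finset.sum_neg_distrib] at this
  linarith

lemma logTrigMGF_nonneg {d : ℕ} (hd : 0 < d) (hev : Even d) (c b : ℝ) :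
    0 ≤ logTrigMGF d c b := by
  obtain ⟨e, rfl⟩ := hev
  have he : 0 < e := by omega
  unfold logTrigMGF
  rw [trigMean_eq_mean_cosh he]
  exact Real.log_nonneg (le_mean_of_le he fun k => Real.one_le_cosh _)

lemma logTrigMGF_le_half_sq {d : ℕ} (hd : 0 < d) (hev : Even d) (c b : ℝ) :
    logTrigMGF d c b ≤ (c ^ 2 + b ^ 2) / 2 := by
  have hpos := trigMean_pos hd c b
  obtain ⟨e, rfl⟩ := hev
  have he : 0 < e := by omega
  unfold logTrigMGF
  rw [Real.log_le_iff_le_exp hpos, trigMean_eq_mean_cosh he]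
  refine mean_le_of_le he fun k => (Real.cosh_le_exp_half_sq _).trans ?_
  gcongr
  set x := 2 * (k : ℝ) * Real.pi / (e + e : ℕ)
  nlinarith [Real.sin_sq_add_cos_sq x, sq_nonneg (c * Real.sin x - b * Real.cos x)]

lemma logTrigMGF_sub_le {d : ℕ} (hd : 0 < d) (c b c' b' : ℝ) :
    logTrigMGF d c b - logTrigMGF d c' b' ≤ |c - c'| + |b - b'| := by
  have h1 := trigMean_pos hd c b
  have h2 := trigMean_pos hd c' b'
  rw [sub_le_iff_le_add']
  unfold logTrigMGF
  rw [← Real.log_exp (|c - c'| + |b - b'|), ← Real.log_mul h2.ne' (Real.exp_ne_zero _)]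
  refine Real.log_le_log h1 ?_
  rw [mul_assoc, Finset.sum_mul]
  gcongr with k _
  rw [← Real.exp_add, Real.exp_le_exp]
  set x := 2 * (k : ℝ) * Real.pi / d
  have h3 : (c - c') * Real.cos x ≤ |c - c'| := by
    refine (le_abs_self _).trans ?_
    rw [abs_mul]
    exact mul_le_of_le_one_right (abs_nonneg _) (Real.abs_cos_le_one x)
  have h4 : (b - b') * Real.sin x ≤ |b - b'| := by
    refine (le_abs_self _).trans ?_
    rw [abs_mul]
    exact mul_le_of_le_one_right (abs_nonneg _) (Real.abs_sin_le_one x)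
  linarith

lemma abs_logTrigMGF_sub_le {d : ℕ} (hd : 0 < d) (c b c' b' : ℝ) :
    |logTrigMGF d c b - logTrigMGF d c' b'| ≤ |c - c'| + |b - b'| := by
  rw [abs_le]
  have h1 := logTrigMGF_sub_le hd c b c' b'
  have h2 := logTrigMGF_sub_le hd c' b' c b
  rw [abs_sub_comm c', abs_sub_comm b'] at h2
  constructor <;> linarith

lemma abs_alphad_sub_le {d : ℕ} (hd : 0 < d) (u v : ℝ) :
    |alphad d u - alphad d v| ≤ |u - v| := by
  have := abs_logTrigMGF_sub_le hd u 0 v 0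
  simpa [logTrigMGF_zero_right] using this

lemma continuous_alphad {d : ℕ} (hd : 0 < d) : Continuous (alphad d) := by
  have : LipschitzWith 1 (alphad d) := LipschitzWith.of_dist_le_mul fun u v => by
    simpa [Real.dist_eq] using abs_alphad_sub_le hd u v
  exact this.continuous

lemma alphad_neg {d : ℕ} (hd : 0 < d) (hev : Even d) (u : ℝ) : alphad d (-u) = alphad d u := by
  have := logTrigMGF_neg_neg hd hev u 0
  simpa [logTrigMGF_zero_right] using this

lemma alphad_nonneg {d : ℕ} (hd : 0 < d) (hev : Even d) (u : ℝ) : 0 ≤ alphad d u := by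
  simpa [logTrigMGF_zero_right] using logTrigMGF_nonneg hd hev u 0

lemma alphad_le_half_sq {d : ℕ} (hd : 0 < d) (hev : Even d) (u : ℝ) :
    alphad d u ≤ u ^ 2 / 2 := by
  simpa [logTrigMGF_zero_right] using logTrigMGF_le_half_sq hd hev u 0

lemma alphad_zero {d : ℕ} (hd : 0 < d) : alphad d 0 = 0 := by
  have : (d : ℝ) ≠ 0 := by exact_mod_cast hd.ne'
  simp [alphad, this]

lemma alphad_le_self {d : ℕ} (hd : 0 < d) {u : ℝ} (hu : 0 ≤ u) : alphad d u ≤ u := by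
  have := abs_alphad_sub_le hd u 0
  rw [alphad_zero hd, sub_zero, sub_zero, abs_of_nonneg hu] at this
  exact (le_abs_self _).trans this

lemma antitone_alphad_sub_self {d : ℕ} (hd : 0 < d) : Antitone fun u => alphad d u - u := by
  intro u v huv
  have := (abs_le.1 (abs_alphad_sub_le hd v u)).2
  rw [abs_of_nonneg (by linarith : 0 ≤ v - u)] at this
  simp only
  linarith

lemma monotoneOn_alphad {d : ℕ} (hd : 0 < d) (hev : Even d) :
    MonotoneOn (alphad d) (Set.Ici 0) := by
  intro u hu v hv huv
  rw [← logTrigMGF_zero_right, ← logTrigMGF_zero_right]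
  have hpos := trigMean_pos hd u 0
  obtain ⟨e, rfl⟩ := hev
  have he : 0 < e := by omega
  unfold logTrigMGF
  refine Real.log_le_log hpos ?_
  rw [trigMean_eq_mean_cosh he, trigMean_eq_mean_cosh he]
  gcongr with k _
  rw [Real.cosh_le_cosh]
  simp only [zero_mul, add_zero, abs_mul]
  rw [abs_of_nonneg (Set.mem_Ici.1 hu), abs_of_nonneg (Set.mem_Ici.1 hv)]
  gcongr

/-- A lower bound for `α_d` that is uniform in `d`. -/
lemma le_alphad {d : ℕ} (hd : 0 < d) {u : ℝ} (hu : 1 ≤ u) :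
    u - (Real.log u / 2 + (Real.log (2 * Real.pi) + 1 / 2)) ≤ alphad d u := by
  have hd' : (0 : ℝ) < d := by exact_mod_cast hd
  have hpi := Real.pi_gt_three
  have hs : 1 ≤ Real.sqrt u := Real.one_le_sqrt.2 hu
  have hss : Real.sqrt u ^ 2 = u := Real.sq_sqrt (by linarith)
  set r := (d : ℝ) / (2 * Real.pi * Real.sqrt u) with hr
  have hr0 : 0 ≤ r := by positivity
  set N := ⌊r⌋₊ + 1 with hN
  have hNr : r ≤ N := by
    rw [hN]; push_cast; exact (Nat.lt_floor_add_one r).le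
  have hrd : r < d := by
    rw [hr, div_lt_iff₀ (by positivity)]
    have : 1 < 2 * Real.pi * Real.sqrt u := by nlinarith
    nlinarith
  have hNd : N ≤ d := by
    have : (⌊r⌋₊ : ℝ) < d := (Nat.floor_le hr0).trans_lt hrd
    have : ⌊r⌋₊ < d := by exact_mod_cast this
    omega
  have hterm : ∀ k ∈ Finset.range N,
      Real.exp (u - 1 / 2) ≤ Real.exp (u * Real.cos (2 * k * Real.pi / d)) := by
    intro k hk
    have hk' : (k : ℝ) ≤ r := by
      have : k ≤ ⌊r⌋₊ := by have := Finset.mem_range.1 hk; omega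
      exact (Nat.cast_le.2 this).trans (Nat.floor_le hr0)
    rw [Real.exp_le_exp]
    set x := 2 * (k : ℝ) * Real.pi / d with hx
    have hx0 : 0 ≤ x := by positivity
    have hx1 : x * Real.sqrt u ≤ 1 := by
      rw [hr, le_div_iff₀ (by positivity)] at hk'
      rw [hx, div_mul_eq_mul_div, div_le_one hd']
      linarith
    have hx2 : x ^ 2 * u ≤ 1 := by
      rw [← hss, ← mul_pow]
      exact pow_le_one₀ (by positivity) hx1
    have := Real.one_sub_sq_div_two_le_cos (x := x)
    nlinarith
  have hsum : N * Real.exp (u - 1 / 2) ≤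
      ∑ k ∈ Finset.range d, Real.exp (u * Real.cos (2 * k * Real.pi / d)) := by
    calc N * Real.exp (u - 1 / 2) = ∑ k ∈ Finset.range N, Real.exp (u - 1 / 2) := by simp
      _ ≤ ∑ k ∈ Finset.range N, Real.exp (u * Real.cos (2 * k * Real.pi / d)) :=
        Finset.sum_le_sum hterm
      _ ≤ _ := Finset.sum_le_sum_of_subset_of_nonneg (Finset.range_mono hNd)
        fun _ _ _ => (Real.exp_pos _).le
  have hmean : 1 / (2 * Real.pi * Real.sqrt u) * Real.exp (u - 1 / 2) ≤
      (1 / d : ℝ) * ∑ k ∈ Finset.range d, Real.exp (u * Real.cos (2 * k * Real.pi / d)) := by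
    calc 1 / (2 * Real.pi * Real.sqrt u) * Real.exp (u - 1 / 2)
        = (1 / d : ℝ) * (r * Real.exp (u - 1 / 2)) := by rw [hr]; field_simp
      _ ≤ (1 / d : ℝ) * (N * Real.exp (u - 1 / 2)) := by gcongr
      _ ≤ _ := by gcongr
  have hlog := Real.log_le_log (by positivity) hmean
  rw [Real.log_mul (by positivity) (by positivity), Real.log_exp, one_div, Real.log_inv,
    Real.log_mul (by positivity) (by positivity), Real.log_sqrt (by linarith)] at hlog
  unfold alphad
  linarith

open MeasureTheory in
lemma intervalIntegrable_div_sq {φ : ℝ → ℝ} (hc : Continuous φ) {l h : ℝ} (hl : 0 < l)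
    (hlh : l ≤ h) : IntervalIntegrable (fun u => φ u / u ^ 2) volume l h := by
  refine ContinuousOn.intervalIntegrable ?_
  rw [Set.uIcc_of_le hlh]
  refine hc.continuousOn.div (by fun_prop) fun u hu => ?_
  have : 0 < u := hl.trans_le hu.1
  positivity

lemma integral_const_div_sq (c : ℝ) {l h : ℝ} (hl : 0 < l) (hlh : l ≤ h) :
    ∫ u in l..h, c / u ^ 2 = c * (1 / l - 1 / h) := by
  rw [intervalIntegral.integral_eq_sub_of_hasDerivAt (f := fun u => -c * u⁻¹) ?_
    (intervalIntegrable_div_sq continuous_const hl hlh)]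
  · ring
  · intro u hu
    rw [Set.uIcc_of_le hlh] at hu
    have hu0 : u ≠ 0 := (hl.trans_le hu.1).ne'
    exact ((hasDerivAt_inv hu0).const_mul (-c)).congr_deriv (by ring)

lemma integral_div_sq_le {φ : ℝ → ℝ} (hc : Continuous φ) {c l h : ℝ} (hl : 0 < l)
    (hlh : l ≤ h) (hφ : ∀ u ∈ Set.Icc l h, φ u ≤ c) :
    ∫ u in l..h, φ u / u ^ 2 ≤ c * (1 / l - 1 / h) := by
  rw [← integral_const_div_sq c hl hlh]
  refine intervalIntegral.integral_mono_on hlh (intervalIntegrable_div_sq hc hl hlh)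
    (intervalIntegrable_div_sq continuous_const hl hlh) fun u hu => ?_
  have := hφ u hu
  gcongr

lemma le_integral_div_sq {φ : ℝ → ℝ} (hc : Continuous φ) {c l h : ℝ} (hl : 0 < l)
    (hlh : l ≤ h) (hφ : ∀ u ∈ Set.Icc l h, c ≤ φ u) :
    c * (1 / l - 1 / h) ≤ ∫ u in l..h, φ u / u ^ 2 := by
  rw [← integral_const_div_sq c hl hlh]
  refine intervalIntegral.integral_mono_on hlh
    (intervalIntegrable_div_sq continuous_const hl hlh)
    (intervalIntegrable_div_sq hc hl hlh) fun u hu => ?_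
  have := hφ u hu
  gcongr

/-- Comparison of `∑ φ(a/(j+1/2))` with `a ∫ φ(u)/u² du` for antitone `φ`. -/
lemma sum_vs_integral_of_antitoneOn {φ : ℝ → ℝ} (hc : Continuous φ)
    (hφ : AntitoneOn φ (Set.Ici 0)) {a : ℝ} (ha : 0 < a) {m n : ℕ} (hmn : m ≤ n) :
    0 ≤ a * (∫ u in (a / (n + 1 / 2))..(a / (m + 1 / 2)), φ u / u ^ 2) -
        ∑ j ∈ Finset.Ico m n, φ (a / (j + 1 / 2)) ∧
    a * (∫ u in (a / (n + 1 / 2))..(a / (m + 1 / 2)), φ u / u ^ 2) -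
        ∑ j ∈ Finset.Ico m n, φ (a / (j + 1 / 2)) ≤
      φ (a / (n + 1 / 2)) - φ (a / (m + 1 / 2)) := by
  induction n, hmn using Nat.le_induction with
  | base => simp
  | succ n hmn ih =>
    have hpos : ∀ k : ℕ, 0 < a / ((k : ℝ) + 1 / 2) := fun k => by positivity
    have hle1 : a / ((n : ℝ) + 1 / 2) ≤ a / ((m : ℝ) + 1 / 2) := by gcongr
    have hle2 : a / (((n + 1 : ℕ) : ℝ) + 1 / 2) ≤ a / ((n : ℝ) + 1 / 2) := by
      gcongr
      omega
    rw [← intervalIntegral.integral_add_adjacent_intervals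
      (intervalIntegrable_div_sq hc (hpos (n + 1)) hle2)
      (intervalIntegrable_div_sq hc (hpos n) hle1), Finset.sum_Ico_succ_top hmn]
    have h1 := le_integral_div_sq (c := φ (a / (n + 1 / 2))) hc (hpos (n + 1)) hle2
      fun u hu => hφ ((hpos (n + 1)).le.trans hu.1) (hpos n).le hu.2
    have h2 := integral_div_sq_le (c := φ (a / ((n + 1 : ℕ) + 1 / 2))) hc (hpos (n + 1)) hle2
      fun u hu => hφ (hpos (n + 1)).le ((hpos (n + 1)).le.trans hu.1) hu.1
    have h3 : a * (1 / (a / (((n + 1 : ℕ) : ℝ) + 1 / 2)) - 1 / (a / ((n : ℝ) + 1 / 2))) = 1 := by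
      push_cast
      field_simp
      ring
    have h4 := mul_le_mul_of_nonneg_left h1 ha.le
    have h5 := mul_le_mul_of_nonneg_left h2 ha.le
    rw [mul_left_comm, h3, mul_one] at h4 h5
    constructor <;> linarith [ih.1, ih.2]

lemma harmonic_bounds {n : ℕ} (hn : 0 < n) :
    Real.log n + Real.eulerMascheroniConstant ≤ harmonic n ∧
    (harmonic n : ℝ) ≤ Real.log n + Real.eulerMascheroniConstant + 1 / n := by
  have hn' : (0 : ℝ) < n := by exact_mod_cast hn
  have h1 := Real.eulerMascheroniSeq_lt_eulerMascheroniConstant n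
  have h2 := Real.eulerMascheroniConstant_lt_eulerMascheroniSeq' n
  simp only [Real.eulerMascheroniSeq, Real.eulerMascheroniSeq', hn.ne', if_false] at h1 h2
  have h3 : Real.log (n + 1) ≤ Real.log n + 1 / n := by
    have := Real.log_le_sub_one_of_pos (show (0 : ℝ) < (n + 1) / n by positivity)
    rw [Real.log_div (by positivity) (by positivity)] at this
    have h4 : ((n : ℝ) + 1) / n - 1 = 1 / n := by field_simp; ring
    linarith
  constructor <;> linarith

lemma sum_inv_add_half (n : ℕ) :
    ∑ j ∈ Finset.range n, 1 / ((j : ℝ) + 1 / 2) = 2 * harmonic (2 * n) - harmonic n := by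
  induction n with
  | zero => simp
  | succ n ih =>
    rw [Finset.sum_range_succ, ih, show 2 * (n + 1) = 2 * n + 1 + 1 by ring, harmonic_succ,
      harmonic_succ, harmonic_succ]
    push_cast
    field_simp
    ring

lemma abs_sum_inv_add_half_sub_le {n : ℕ} (hn : 0 < n) :
    |∑ j ∈ Finset.range n, 1 / ((j : ℝ) + 1 / 2) -
      (Real.log n + Real.log 4 + Real.eulerMascheroniConstant)| ≤ 1 / n := by
  have hn' : (0 : ℝ) < n := by exact_mod_cast hn
  rw [sum_inv_add_half]
  obtain ⟨h1, h2⟩ := harmonic_bounds hn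
  obtain ⟨h3, h4⟩ := harmonic_bounds (n := 2 * n) (by omega)
  push_cast at h3 h4
  have h5 : Real.log (2 * n) = Real.log 2 + Real.log n := Real.log_mul (by norm_num) hn'.ne'
  have h6 : Real.log 4 = 2 * Real.log 2 := by
    rw [show (4 : ℝ) = 2 ^ 2 by norm_num, Real.log_pow]; norm_num
  have h7 : 1 / (2 * (n : ℝ)) * 2 = 1 / n := by field_simp
  rw [abs_le]
  constructor <;> linarith

lemma abs_log_sub_log_le {a n : ℝ} (ha : 1 / 2 ≤ a) (hn : 1 ≤ n) (h : |n - a| ≤ 1 / 2) :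
    a * |Real.log n - Real.log a| ≤ 1 := by
  obtain ⟨h1, h2⟩ := abs_le.1 h
  have ha0 : 0 < a := by linarith
  have hn0 : 0 < n := by linarith
  have h3 := Real.log_le_sub_one_of_pos (show 0 < n / a by positivity)
  have h4 := Real.log_le_sub_one_of_pos (show 0 < a / n by positivity)
  rw [Real.log_div hn0.ne' ha0.ne'] at h3
  rw [Real.log_div ha0.ne' hn0.ne'] at h4
  have h5 : a * (n / a - 1) ≤ 1 := by
    rw [show a * (n / a - 1) = n - a by field_simp]; linarith
  have h6 : a * (a / n - 1) ≤ 1 := by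
    rw [show a * (a / n - 1) = a * (a - n) / n by field_simp, div_le_one hn0]
    nlinarith
  rcases abs_cases (Real.log n - Real.log a) with ⟨h7, _⟩ | ⟨h7, _⟩ <;> rw [h7]
  · exact (mul_le_mul_of_nonneg_left h3 ha0.le).trans h5
  · exact (mul_le_mul_of_nonneg_left (by linarith) ha0.le).trans h6

/-- The defect bound for `α_d(u)` against `u`, uniform in `d`. -/
def alphadDefect (u : ℝ) : ℝ := Real.log u / 2 + (Real.log (2 * Real.pi) + 1 / 2)

lemma log_two_mul_pi_pos : 0 < Real.log (2 * Real.pi) :=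
  Real.log_pos (by linarith [Real.pi_gt_three])

lemma hasDerivAt_alphadDefect_primitive {u : ℝ} (hu : 0 < u) :
    HasDerivAt (fun u => -((alphadDefect u + 1 / 2) * u⁻¹)) (alphadDefect u / u ^ 2) u := by
  unfold alphadDefect
  have h := ((((Real.hasDerivAt_log hu.ne').div_const 2).add_const
    (Real.log (2 * Real.pi) + 1 / 2)).add_const (1 / 2)).mul (hasDerivAt_inv hu.ne')
  exact h.neg.congr_deriv (by field_simp; ring)

open Filter Topology in
lemma tendsto_alphadDefect_primitive :
    Tendsto (fun u => -((alphadDefect u + 1 / 2) * u⁻¹)) atTop (𝓝 0) := by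
  have h1 : Tendsto (fun u : ℝ => Real.log u / u) atTop (𝓝 0) := by
    have := Real.isLittleO_log_id_atTop.tendsto_div_nhds_zero
    simpa using this
  have h2 : Tendsto (fun u : ℝ => u⁻¹) atTop (𝓝 0) := tendsto_inv_atTop_zero
  have h3 := ((h1.const_mul (1 / 2)).add
    (h2.const_mul (Real.log (2 * Real.pi) + 1 / 2 + 1 / 2))).neg
  simp only [mul_zero, add_zero, neg_zero] at h3
  refine h3.congr fun u => ?_
  unfold alphadDefect
  ring

lemma alphadDefect_nonneg {u : ℝ} (hu : 1 ≤ u) : 0 ≤ alphadDefect u := by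
  have h1 := Real.log_nonneg hu
  have h2 := log_two_mul_pi_pos
  unfold alphadDefect
  positivity

open MeasureTheory in
lemma integrableOn_alphadDefect {U : ℝ} (hU : 1 ≤ U) :
    IntegrableOn (fun u => alphadDefect u / u ^ 2) (Set.Ioi U) :=
  integrableOn_Ioi_deriv_of_nonneg'
    (fun _ hu => hasDerivAt_alphadDefect_primitive (by linarith [Set.mem_Ici.1 hu]))
    (fun _ hu => div_nonneg (alphadDefect_nonneg (by linarith [Set.mem_Ioi.1 hu])) (sq_nonneg _))
    tendsto_alphadDefect_primitive

lemma integral_alphadDefect {U : ℝ} (hU : 1 ≤ U) :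
    ∫ u in Set.Ioi U, alphadDefect u / u ^ 2 = (alphadDefect U + 1 / 2) / U := by
  rw [MeasureTheory.integral_Ioi_of_hasDerivAt_of_nonneg'
    (fun _ hu => hasDerivAt_alphadDefect_primitive (by linarith [Set.mem_Ici.1 hu]))
    (fun _ hu => div_nonneg (alphadDefect_nonneg (by linarith [Set.mem_Ioi.1 hu])) (sq_nonneg _))
    tendsto_alphadDefect_primitive]
  ring

lemma abs_alphad_sub_self_le {d : ℕ} (hd : 0 < d) {u : ℝ} (hu : 1 ≤ u) :
    |alphad d u - u| ≤ alphadDefect u := by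
  have h1 := le_alphad hd hu
  have h2 := alphad_le_self hd (by linarith : 0 ≤ u)
  rw [abs_of_nonpos (by linarith)]
  unfold alphadDefect
  linarith

open MeasureTheory in
lemma integrableOn_alphad_sub_self {d : ℕ} (hd : 0 < d) {U : ℝ} (hU : 1 ≤ U) :
    IntegrableOn (fun u => (alphad d u - u) / u ^ 2) (Set.Ioi U) := by
  refine (integrableOn_alphadDefect hU).mono' ?_ ?_
  · have := continuous_alphad hd
    exact (Measurable.aestronglyMeasurable (by fun_prop))
  · refine (ae_restrict_iff' measurableSet_Ioi).2 (Filter.Eventually.of_forall fun u hu => ?_)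
    rw [Real.norm_eq_abs, abs_div, abs_of_nonneg (sq_nonneg u)]
    have := abs_alphad_sub_self_le hd (u := u) (by linarith [Set.mem_Ioi.1 hu])
    gcongr

open MeasureTheory in
lemma abs_integral_alphad_sub_self_le {d : ℕ} (hd : 0 < d) {U : ℝ} (hU : 1 ≤ U) :
    |∫ u in Set.Ioi U, (alphad d u - u) / u ^ 2| ≤ (alphadDefect U + 1 / 2) / U := by
  rw [← integral_alphadDefect hU, ← Real.norm_eq_abs]
  refine norm_integral_le_of_norm_le (integrableOn_alphadDefect hU) ?_
  refine (ae_restrict_iff' measurableSet_Ioi).2 (Filter.Eventually.of_forall fun u hu => ?_)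
  rw [Real.norm_eq_abs, abs_div, abs_of_nonneg (sq_nonneg u)]
  have := abs_alphad_sub_self_le hd (u := u) (by linarith [Set.mem_Ioi.1 hu])
  gcongr

lemma alphad_div_sq_le {d : ℕ} (hd : 0 < d) (hev : Even d) (u : ℝ) :
    ‖alphad d u / u ^ 2‖ ≤ 1 / 2 := by
  rw [Real.norm_of_nonneg (div_nonneg (alphad_nonneg hd hev u) (sq_nonneg u))]
  refine div_le_of_le_mul₀ (sq_nonneg u) (by norm_num) ?_
  linarith [alphad_le_half_sq hd hev u]

open MeasureTheory in
lemma intervalIntegrable_alphad {d : ℕ} (hd : 0 < d) (hev : Even d) (x y : ℝ) :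
    IntervalIntegrable (fun u => alphad d u / u ^ 2) volume x y := by
  refine (intervalIntegrable_const (c := (1 / 2 : ℝ))).mono_fun ?_ ?_
  · have := continuous_alphad hd
    exact (Measurable.aestronglyMeasurable (by fun_prop))
  · exact Filter.Eventually.of_forall fun u =>
      (alphad_div_sq_le hd hev u).trans (Real.le_norm_self _)

lemma abs_integral_alphad_le {d : ℕ} (hd : 0 < d) (hev : Even d) (x y : ℝ) :
    |∫ u in x..y, alphad d u / u ^ 2| ≤ 1 / 2 * |y - x| := by
  rw [← Real.norm_eq_abs]
  exact intervalIntegral.norm_integral_le_of_norm_le_const fun u _ => alphad_div_sq_le hd hev u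

/-- The part `u ≥ 1` of the sum, after removing the main term `u` from `α_d(u)`. -/
lemma abs_sum_alphad_sub_self_le {d : ℕ} (hd : 0 < d) {a : ℝ} (ha : 1 / 2 ≤ a) {n : ℕ}
    (hn1 : (n : ℝ) + 1 / 2 ≤ a) (hn2 : a ≤ (n : ℝ) + 3 / 2) :
    |∑ j ∈ Finset.range (n + 1), (alphad d (a / (j + 1 / 2)) - a / (j + 1 / 2)) -
      a * ∫ u in Set.Ioi (1 : ℝ), (alphad d u - u) / u ^ 2| ≤
      4 * (alphadDefect (2 * a) + 1 / 2) := by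
  have ha0 : 0 < a := by linarith
  have h2a : 1 ≤ 2 * a := by linarith
  set φ : ℝ → ℝ := fun u => alphad d u - u with hφ
  have hc : Continuous φ := (continuous_alphad hd).sub continuous_id
  have hanti : Antitone φ := antitone_alphad_sub_self hd
  have hφ0 : φ 0 = 0 := by simp [hφ, alphad_zero hd]
  have hφB : ∀ u ∈ Set.Icc 0 (2 * a), φ u ≤ 0 ∧ -alphadDefect (2 * a) ≤ φ u := by
    intro u hu
    refine ⟨hφ0 ▸ hanti hu.1, le_trans ?_ (hanti hu.2)⟩
    exact (abs_le.1 (abs_alphad_sub_self_le hd h2a)).1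
  have hn0 : (0 : ℝ) ≤ n := Nat.cast_nonneg n
  have hu0 : a / (((0 : ℕ) : ℝ) + 1 / 2) = 2 * a := by push_cast; field_simp; ring
  have hun1 : 1 ≤ a / ((n : ℝ) + 1 / 2) := by rw [le_div_iff₀ (by positivity)]; linarith
  have hun2 : a / ((n : ℝ) + 1 / 2) ≤ 2 * a := by
    rw [← hu0]
    gcongr
    simp
  obtain ⟨h1, h2⟩ := sum_vs_integral_of_antitoneOn hc (hanti.antitoneOn _) ha0 (Nat.zero_le n)
  rw [hu0] at h1 h2
  have h3 := hφB (a / ((n : ℝ) + 1 / 2)) ⟨by linarith, hun2⟩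
  have h3' := hφB (2 * a) ⟨by linarith, le_rfl⟩
  have h4 := integral_div_sq_le hc one_pos hun1 (c := 0)
    fun u hu => (hφB u ⟨by linarith [hu.1], hu.2.trans hun2⟩).1
  have h5 := le_integral_div_sq hc one_pos hun1 (c := -alphadDefect (2 * a))
    fun u hu => (hφB u ⟨by linarith [hu.1], hu.2.trans hun2⟩).2
  have h6 : a * (1 / 1 - 1 / (a / ((n : ℝ) + 1 / 2))) = a - (n + 1 / 2) := by
    field_simp
  have h7 := mul_le_mul_of_nonneg_left h4 ha0.le
  have h8 := mul_le_mul_of_nonneg_left h5 ha0.le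
  rw [mul_left_comm, h6] at h7 h8
  have hB := alphadDefect_nonneg h2a
  have h9 := abs_integral_alphad_sub_self_le hd h2a
  have h10 : a * |∫ u in Set.Ioi (2 * a), φ u / u ^ 2| ≤ alphadDefect (2 * a) + 1 / 2 := by
    calc a * |∫ u in Set.Ioi (2 * a), φ u / u ^ 2|
        ≤ a * ((alphadDefect (2 * a) + 1 / 2) / (2 * a)) := mul_le_mul_of_nonneg_left h9 ha0.le
      _ = (alphadDefect (2 * a) + 1 / 2) / 2 := by field_simp
      _ ≤ _ := by linarith
  have h11 : ∫ u in Set.Ioi (1 : ℝ), φ u / u ^ 2 =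
      (∫ u in (1 : ℝ)..(a / ((n : ℝ) + 1 / 2)), φ u / u ^ 2) +
      (∫ u in (a / ((n : ℝ) + 1 / 2))..(2 * a), φ u / u ^ 2) +
      ∫ u in Set.Ioi (2 * a), φ u / u ^ 2 := by
    rw [intervalIntegral.integral_add_adjacent_intervals
      (intervalIntegrable_div_sq hc one_pos hun1)
      (intervalIntegrable_div_sq hc (one_pos.trans_le hun1) hun2),
      ← intervalIntegral.integral_Ioi_sub_Ioi (integrableOn_alphad_sub_self hd le_rfl) h2a]
    ring
  rw [← abs_of_pos ha0, ← abs_mul, abs_of_pos ha0] at h10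
  have h12 := abs_le.1 h10
  change |∑ j ∈ Finset.range (n + 1), φ (a / (j + 1 / 2)) -
      a * ∫ u in Set.Ioi (1 : ℝ), φ u / u ^ 2| ≤ _
  rw [h11, Finset.sum_range_succ, Finset.range_eq_Ico, mul_add, mul_add]
  have h13 : -alphadDefect (2 * a) ≤ -alphadDefect (2 * a) * (a - (n + 1 / 2)) := by
    nlinarith
  rw [abs_le]
  constructor <;> linarith [h12.1, h12.2]

/-- The part `u < 1` of the sum. -/
lemma abs_sum_Ico_alphad_le {d : ℕ} (hd : 0 < d) (hev : Even d) {a : ℝ} (ha : 0 < a) {m n : ℕ}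
    (hm1 : a ≤ (m : ℝ) + 1 / 2) (hm2 : (m : ℝ) ≤ a + 1 / 2) (hmn : m ≤ n) (han : a ^ 2 ≤ n) :
    |∑ j ∈ Finset.Ico m n, alphad d (a / (j + 1 / 2)) -
      a * ∫ u in (0 : ℝ)..1, alphad d u / u ^ 2| ≤ 2 := by
  have hc : Continuous fun u => -alphad d u := (continuous_alphad hd).neg
  have hanti : AntitoneOn (fun u => -alphad d u) (Set.Ici 0) := (monotoneOn_alphad hd hev).neg
  obtain ⟨h1, h2⟩ := sum_vs_integral_of_antitoneOn hc hanti ha hmn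
  simp only [neg_div, intervalIntegral.integral_neg, Finset.sum_neg_distrib] at h1 h2
  have hm0 : (0 : ℝ) ≤ m := Nat.cast_nonneg m
  have hn0 : (0 : ℝ) ≤ n := Nat.cast_nonneg n
  set x := a / ((n : ℝ) + 1 / 2) with hx
  set y := a / ((m : ℝ) + 1 / 2) with hy
  have hx0 : 0 < x := by positivity
  have hy0 : 0 < y := by positivity
  have hy1 : y ≤ 1 := by rw [hy, div_le_one (by positivity)]; exact hm1
  have h3 : alphad d y ≤ 1 := (alphad_le_self hd hy0.le).trans hy1
  have h4 := alphad_nonneg hd hev x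
  have h5 := mul_le_mul_of_nonneg_left (abs_integral_alphad_le hd hev 0 x) ha.le
  have h6 := mul_le_mul_of_nonneg_left (abs_integral_alphad_le hd hev y 1) ha.le
  rw [sub_zero, abs_of_pos hx0] at h5
  rw [abs_of_nonneg (sub_nonneg.2 hy1)] at h6
  have h7 : a * (1 / 2 * x) ≤ 1 / 2 := by
    rw [hx, show a * (1 / 2 * (a / ((n : ℝ) + 1 / 2))) = 1 / 2 * (a ^ 2 / (n + 1 / 2)) by ring]
    have : a ^ 2 / ((n : ℝ) + 1 / 2) ≤ 1 := by rw [div_le_one (by positivity)]; linarith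
    linarith
  have h8 : a * (1 / 2 * (1 - y)) ≤ 1 / 2 := by
    have h9 : a * (1 - y) = y * (m + 1 / 2 - a) := by rw [hy]; field_simp
    have h10 : y * (m + 1 / 2 - a) ≤ 1 := by nlinarith
    linarith
  have hsplit : ∫ u in (0 : ℝ)..1, alphad d u / u ^ 2 = (∫ u in (0 : ℝ)..x, alphad d u / u ^ 2) +
      (∫ u in x..y, alphad d u / u ^ 2) + ∫ u in y..1, alphad d u / u ^ 2 := by
    rw [intervalIntegral.integral_add_adjacent_intervals (intervalIntegrable_alphad hd hev _ _)
      (intervalIntegrable_alphad hd hev _ _), intervalIntegral.integral_add_adjacent_intervals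
      (intervalIntegrable_alphad hd hev _ _) (intervalIntegrable_alphad hd hev _ _)]
  have h11 := alphad_nonneg hd hev y
  rw [hsplit, mul_add, mul_add]
  rw [← abs_of_pos ha, ← abs_mul, abs_of_pos ha] at h5 h6
  have h12 := abs_le.1 h5
  have h13 := abs_le.1 h6
  have h15 : alphad d x ≤ alphad d y + 1 := by
    have hxy : x ≤ y := by rw [hx, hy]; gcongr
    have := monotoneOn_alphad hd hev hx0.le hy0.le hxy
    linarith
  rw [abs_le]
  constructor <;> linarith [h12.1, h12.2, h13.1, h13.2]

lemma abs_sum_alphad_sub_le {d : ℕ} (hd : 0 < d) (hev : Even d) {s : ℝ} (hs : 2 ≤ s) {n : ℕ}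
    (hn : s ^ 2 ≤ n) :
    |∑ j ∈ Finset.range n, alphad d (s / Real.pi / (j + 1 / 2)) -
      (s / Real.pi * Real.log s + Cd d * s / 2)| ≤
      2 * Real.log s + 4 * Real.log (2 * Real.pi) + 10 := by
  have hpi := Real.pi_gt_three
  have hpi4 := Real.pi_le_four
  have hpi0 := Real.pi_pos
  set a := s / Real.pi with ha
  have ha1 : 1 / 2 ≤ a := by rw [ha, le_div_iff₀ hpi0]; linarith
  have ha0 : 0 < a := by linarith
  have has : a ≤ s / 2 := by rw [ha]; gcongr; linarith
  set M := ⌊a - 1 / 2⌋₊ with hM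
  have hM1 : (M : ℝ) + 1 / 2 ≤ a := by
    have := Nat.floor_le (sub_nonneg.2 ha1)
    linarith
  have hM2 : a ≤ (M : ℝ) + 3 / 2 := by
    have := (Nat.lt_floor_add_one (a - 1 / 2)).le
    linarith
  have hMn : M + 1 ≤ n := by
    have : ((M + 1 : ℕ) : ℝ) ≤ n := by push_cast; nlinarith
    exact_mod_cast this
  have hM0 : (0 : ℝ) ≤ M := Nat.cast_nonneg M
  have h1 := abs_le.1 (abs_sum_alphad_sub_self_le hd ha1 hM1 hM2)
  have h2 := abs_le.1 (abs_sum_Ico_alphad_le hd hev ha0 (m := M + 1) (n := n)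
    (by push_cast; linarith) (by push_cast; linarith) hMn (by nlinarith))
  have h3 := mul_le_mul_of_nonneg_left
    (abs_sum_inv_add_half_sub_le (n := M + 1) (by omega)) ha0.le
  have h4 := abs_log_sub_log_le (a := a) (n := (M + 1 : ℕ)) ha1 (by push_cast; linarith)
    (by push_cast; rw [abs_le]; constructor <;> linarith)
  have h5 : a * (1 / ((M + 1 : ℕ) : ℝ)) ≤ 2 := by
    push_cast
    rw [mul_one_div, div_le_iff₀ (by positivity)]
    linarith
  rw [← abs_of_pos ha0, ← abs_mul, abs_of_pos ha0] at h3 h4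
  have h6 := abs_le.1 (h3.trans h5)
  have h7 := abs_le.1 h4
  have hloga : Real.log a = Real.log s - Real.log Real.pi := Real.log_div (by linarith) hpi0.ne'
  have hlog4 : Real.log (4 / Real.pi) = Real.log 4 - Real.log Real.pi :=
    Real.log_div (by norm_num) hpi0.ne'
  have hdef : alphadDefect (2 * a) ≤ Real.log s / 2 + (Real.log (2 * Real.pi) + 1 / 2) := by
    unfold alphadDefect
    have := Real.log_le_log (by positivity) (by linarith : 2 * a ≤ s)
    linarith
  have hsum : ∑ j ∈ Finset.range n, alphad d (a / (j + 1 / 2)) =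
      a * ∑ j ∈ Finset.range (M + 1), 1 / ((j : ℝ) + 1 / 2) +
      ∑ j ∈ Finset.range (M + 1), (alphad d (a / (j + 1 / 2)) - a / (j + 1 / 2)) +
      ∑ j ∈ Finset.Ico (M + 1) n, alphad d (a / (j + 1 / 2)) := by
    rw [Finset.mul_sum, ← Finset.sum_add_distrib, Finset.range_eq_Ico, Finset.range_eq_Ico,
      ← Finset.sum_Ico_consecutive _ (Nat.zero_le _) hMn]
    congr 1
    exact Finset.sum_congr rfl fun j _ => by ring
  have hCd : Cd d * s / 2 = a * Real.eulerMascheroniConstant + a * Real.log (4 / Real.pi) +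
      a * (∫ u in Set.Ioi (1 : ℝ), (alphad d u - u) / u ^ 2) +
      a * ∫ u in (0 : ℝ)..1, alphad d u / u ^ 2 := by
    unfold Cd
    rw [ha]
    field_simp
  rw [hsum, hCd, hlog4]
  rw [hloga] at h7
  rw [abs_le]
  constructor <;> linarith [h1.1, h1.2, h2.1, h2.2, h6.1, h6.2, h7.1, h7.2]

lemma inv_exp_two_mul_I_sub_one {θ : ℝ} (h : Real.sin θ ≠ 0) :
    Complex.I / (Complex.exp ((2 * θ : ℝ) * Complex.I) - 1) =
      ((Real.cos θ / Real.sin θ / 2 : ℝ) : ℂ) - Complex.I / 2 := by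
  have hs : ((Real.sin θ : ℝ) : ℂ) ≠ 0 := by exact_mod_cast h
  have key : (((Real.cos θ / Real.sin θ / 2 : ℝ) : ℂ) - Complex.I / 2) *
      (Complex.exp ((2 * θ : ℝ) * Complex.I) - 1) = Complex.I := by
    rw [Complex.exp_mul_I, ← Complex.ofReal_cos, ← Complex.ofReal_sin, Real.cos_two_mul',
      Real.sin_two_mul]
    have hsc : ((Real.sin θ : ℝ) : ℂ) ^ 2 + ((Real.cos θ : ℝ) : ℂ) ^ 2 = 1 := by
      exact_mod_cast Real.sin_sq_add_cos_sq θ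
    push_cast at hs hsc ⊢
    field_simp
    linear_combination (Complex.cos θ + Complex.sin θ * Complex.I) * hsc + (-Complex.sin θ ^ 2 * Complex.cos θ * 2) * Complex.I_sq
  have hne : Complex.exp ((2 * θ : ℝ) * Complex.I) - 1 ≠ 0 := by
    intro h0
    rw [h0, mul_zero] at key
    exact Complex.I_ne_zero key.symm
  rw [div_eq_iff hne, key]

/-- The angle `π(j + 1/2)/p`. -/
def halfAngle (p : ℕ) (j : ℤ) : ℝ := Real.pi * (j + 1 / 2) / p

lemma two_mul_re_term {p d : ℕ} (s : ℝ) (k : ℕ) {j : ℤ} (h : Real.sin (halfAngle p j) ≠ 0) :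
    2 * s * (Complex.I / p * (Complex.exp (2 * Real.pi * Complex.I * (k : ℝ) / d) /
      (ep p ((j : ℝ) + 1 / 2) - 1))).re =
    s / p * (Real.cos (halfAngle p j) / Real.sin (halfAngle p j)) *
      Real.cos (2 * k * Real.pi / d) + s / p * Real.sin (2 * k * Real.pi / d) := by
  have h1 : ep p ((j : ℝ) + 1 / 2) = Complex.exp ((2 * halfAngle p j : ℝ) * Complex.I) := by
    unfold ep halfAngle
    congr 1
    push_cast
    ring
  have h2 : Complex.exp (2 * Real.pi * Complex.I * (k : ℝ) / d) =
      (Real.cos (2 * k * Real.pi / d) : ℝ) + (Real.sin (2 * k * Real.pi / d) : ℝ) * Complex.I := by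
    rw [Complex.ofReal_cos, Complex.ofReal_sin, ← Complex.exp_mul_I]
    congr 1
    push_cast
    ring
  rw [h1, h2]
  set x := 2 * (k : ℝ) * Real.pi / d
  set E := Complex.exp ((2 * halfAngle p j : ℝ) * Complex.I) - 1 with hE
  have h3 : ∀ X : ℂ, Complex.I / p * (X / E) = ((1 / p : ℝ) : ℂ) * (X * (Complex.I / E)) := by
    intro X
    push_cast
    ring
  rw [h3, hE, inv_exp_two_mul_I_sub_one h, Complex.re_ofReal_mul, Complex.mul_re]
  generalize Real.cos (halfAngle p j) / Real.sin (halfAngle p j) = t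
  generalize Real.cos x = c
  generalize Real.sin x = b
  simp
  ring

lemma expectR_exp_sum {ι : Type} [Fintype ι] [DecidableEq ι] {d : ℕ} (f : ι → ℕ → ℝ) :
    expectR (fun ω : ι → Fin d => Real.exp (∑ j, f j (ω j))) =
      ∏ j, ((1 / d : ℝ) * ∑ k ∈ Finset.range d, Real.exp (f j k)) := by
  unfold expectR
  simp_rw [Real.exp_sum, ← Fin.sum_univ_eq_sum_range (fun k => Real.exp (f _ k)) d]
  rw [Finset.prod_mul_distrib, Finset.prod_univ_sum, Finset.prod_const, Finset.card_univ,
    Fintype.piFinset_univ, Fintype.card_fun, Fintype.card_fin]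
  push_cast
  rw [one_div, inv_pow, div_eq_inv_mul]

/-- The logarithm of the Laplace transform of the `j`-th summand of `2 Re G`. -/
def logLaplaceTerm (p d : ℕ) (s : ℝ) (j : ℤ) : ℝ :=
  logTrigMGF d (s / p * (Real.cos (halfAngle p j) / Real.sin (halfAngle p j))) (s / p)

lemma log_expectR_eq {p d : ℕ} (hd : 0 < d) (s : ℝ)
    (h : ∀ j ∈ Jhalf p, Real.sin (halfAngle p j) ≠ 0) :
    Real.log (expectR (fun ω : {j : ℤ // j ∈ Jhalf p} → Fin d =>
      Real.exp (2 * s * (GX p d ω).re))) = ∑ j ∈ Jhalf p, logLaplaceTerm p d s j := by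
  let f : {j : ℤ // j ∈ Jhalf p} → ℕ → ℝ := fun j k =>
    s / p * (Real.cos (halfAngle p j) / Real.sin (halfAngle p j)) *
      Real.cos (2 * k * Real.pi / d) + s / p * Real.sin (2 * k * Real.pi / d)
  have h1 : (fun ω : {j : ℤ // j ∈ Jhalf p} → Fin d => Real.exp (2 * s * (GX p d ω).re)) =
      fun ω => Real.exp (∑ j, f j (ω j)) := by
    funext ω
    congr 1
    unfold GX
    rw [Finset.mul_sum, Complex.re_sum, Finset.mul_sum]
    exact Finset.sum_congr rfl fun j _ => two_mul_re_term s (ω j) (h j j.2)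
  rw [h1, expectR_exp_sum f, Real.log_prod fun j _ => (trigMean_pos hd _ _).ne']
  exact Finset.sum_coe_sort (Jhalf p) (logLaplaceTerm p d s)

lemma halfAngle_neg (p : ℕ) (j : ℤ) : halfAngle p (-(j + 1)) = -halfAngle p j := by
  unfold halfAngle
  push_cast
  ring

lemma Jhalf_eq_Ico (m : ℕ) : Jhalf (2 * m + 1) = Finset.Ico (-(m : ℤ)) (m + 1) := by
  ext j
  simp only [Jhalf, Finset.mem_filter, Finset.mem_Icc, Finset.mem_Ico]
  push_cast
  rcases abs_cases j with ⟨h, _⟩ | ⟨h, _⟩ <;> rw [h] <;> omega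

lemma sum_Ico_neg_eq (g : ℤ → ℝ) (m : ℕ) :
    ∑ j ∈ Finset.Ico (-(m : ℤ)) m, g j =
      ∑ j ∈ Finset.range m, (g j + g (-((j : ℤ) + 1))) := by
  induction m with
  | zero => simp
  | succ m ih =>
    rw [Finset.sum_range_succ, ← ih]
    have h : Finset.Ico (-((m + 1 : ℕ) : ℤ)) (m + 1 : ℕ) =
        insert (m : ℤ) (insert (-((m : ℤ) + 1)) (Finset.Ico (-(m : ℤ)) m)) := by
      ext j
      simp only [Finset.mem_Ico, Finset.mem_insert]
      push_cast
      omega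
    rw [h, Finset.sum_insert (by simp; omega), Finset.sum_insert (by simp)]
    ring

lemma sum_Jhalf_eq (g : ℤ → ℝ) (m : ℕ) :
    ∑ j ∈ Jhalf (2 * m + 1), g j =
      ∑ j ∈ Finset.range m, (g j + g (-((j : ℤ) + 1))) + g m := by
  rw [Jhalf_eq_Ico, ← sum_Ico_neg_eq]
  have h : Finset.Ico (-(m : ℤ)) (m + 1) = insert (m : ℤ) (Finset.Ico (-(m : ℤ)) m) := by
    ext j
    simp only [Finset.mem_Ico, Finset.mem_insert]
    omega
  rw [h, Finset.sum_insert (by simp)]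
  ring

lemma abs_cot_sub_inv_le {θ : ℝ} (h0 : 0 < θ) (h1 : θ ≤ Real.pi / 2) :
    |Real.cos θ / Real.sin θ - 1 / θ| ≤ 1 := by
  have hs : 0 < Real.sin θ := Real.sin_pos_of_pos_of_lt_pi h0 (by linarith [Real.pi_pos])
  have hc : 0 ≤ Real.cos θ := Real.cos_nonneg_of_mem_Icc ⟨by linarith, h1⟩
  have h2 : θ * Real.cos θ ≤ Real.sin θ := by
    rcases h1.lt_or_eq with h | h
    · have hc' : 0 < Real.cos θ := Real.cos_pos_of_mem_Ioo ⟨by linarith, h⟩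
      have := Real.le_tan h0.le h
      rwa [Real.tan_eq_sin_div_cos, le_div_iff₀ hc'] at this
    · rw [h, Real.cos_pi_div_two, mul_zero, Real.sin_pi_div_two]
      exact zero_le_one
  have h3 : Real.sin θ ≤ θ := Real.sin_le h0.le
  have h4 : 1 ≤ Real.cos θ + Real.sin θ := by
    nlinarith [Real.sin_sq_add_cos_sq θ, mul_nonneg hs.le hc]
  have h5 : Real.cos θ / Real.sin θ - 1 / θ =
      (θ * Real.cos θ - Real.sin θ) / (θ * Real.sin θ) := by
    field_simp
  rw [h5, abs_div, abs_of_pos (mul_pos h0 hs), div_le_one (mul_pos h0 hs),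
    abs_of_nonpos (by linarith)]
  nlinarith

lemma halfAngle_mem {m j : ℕ} (hj : j ≤ m) :
    0 < halfAngle (2 * m + 1) j ∧ halfAngle (2 * m + 1) j ≤ Real.pi / 2 := by
  have hpi := Real.pi_pos
  have hj' : (j : ℝ) ≤ m := by exact_mod_cast hj
  unfold halfAngle
  push_cast
  refine ⟨by positivity, ?_⟩
  rw [div_le_div_iff₀ (by positivity) (by norm_num)]
  nlinarith

lemma sin_halfAngle_pos {m j : ℕ} (hj : j ≤ m) : 0 < Real.sin (halfAngle (2 * m + 1) j) := by
  obtain ⟨h0, h1⟩ := halfAngle_mem hj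
  exact Real.sin_pos_of_pos_of_lt_pi h0 (by linarith [Real.pi_pos])

lemma sin_halfAngle_ne_zero {m : ℕ} {j : ℤ} (hj : j ∈ Jhalf (2 * m + 1)) :
    Real.sin (halfAngle (2 * m + 1) j) ≠ 0 := by
  rw [Jhalf_eq_Ico, Finset.mem_Ico] at hj
  rcases le_or_gt 0 j with h | h
  · lift j to ℕ using h
    exact (sin_halfAngle_pos (by omega)).ne'
  · obtain ⟨i, rfl⟩ : ∃ i : ℕ, j = -((i : ℤ) + 1) := ⟨(-j - 1).toNat, by omega⟩
    rw [halfAngle_neg, Real.sin_neg, neg_ne_zero]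
    exact (sin_halfAngle_pos (by omega)).ne'

lemma abs_coeff_sub_le {m j : ℕ} (hj : j ≤ m) {s : ℝ} (hs : 0 ≤ s) :
    |s / (2 * m + 1 : ℕ) * (Real.cos (halfAngle (2 * m + 1) j) /
      Real.sin (halfAngle (2 * m + 1) j)) - s / Real.pi / (j + 1 / 2)| ≤
      s / (2 * m + 1 : ℕ) := by
  obtain ⟨h0, h1⟩ := halfAngle_mem hj
  have hp : (0 : ℝ) < (2 * m + 1 : ℕ) := by positivity
  have h2 : s / Real.pi / ((j : ℝ) + 1 / 2) =
      s / (2 * m + 1 : ℕ) * (1 / halfAngle (2 * m + 1) j) := by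
    have := Real.pi_pos
    unfold halfAngle
    rw [Int.cast_natCast]
    field_simp
  rw [h2, ← mul_sub, abs_mul, abs_of_nonneg (by positivity)]
  exact mul_le_of_le_one_right (by positivity) (abs_cot_sub_inv_le h0 h1)

lemma abs_logLaplaceTerm_sub_le {d m j : ℕ} (hd : 0 < d) (hj : j ≤ m) {s : ℝ} (hs : 0 ≤ s) :
    |logLaplaceTerm (2 * m + 1) d s j - alphad d (s / Real.pi / (j + 1 / 2))| ≤
      2 * (s / (2 * m + 1 : ℕ)) := by
  rw [logLaplaceTerm, ← logTrigMGF_zero_right]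
  refine (abs_logTrigMGF_sub_le hd _ _ _ _).trans ?_
  have h1 := abs_coeff_sub_le hj hs
  have h2 : |s / ((2 * m + 1 : ℕ) : ℝ) - 0| = s / (2 * m + 1 : ℕ) := by
    rw [sub_zero, abs_of_nonneg (by positivity)]
  linarith

lemma logLaplaceTerm_neg (p d : ℕ) (s : ℝ) (j : ℤ) :
    logLaplaceTerm p d s (-(j + 1)) = logTrigMGF d (-(s / p *
      (Real.cos (halfAngle p j) / Real.sin (halfAngle p j)))) (s / p) := by
  rw [logLaplaceTerm, halfAngle_neg, Real.cos_neg, Real.sin_neg, div_neg, mul_neg]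

lemma abs_logLaplaceTerm_neg_sub_le {d m j : ℕ} (hd : 0 < d) (hev : Even d) (hj : j ≤ m)
    {s : ℝ} (hs : 0 ≤ s) :
    |logLaplaceTerm (2 * m + 1) d s (-((j : ℤ) + 1)) - alphad d (s / Real.pi / (j + 1 / 2))| ≤
      2 * (s / (2 * m + 1 : ℕ)) := by
  rw [logLaplaceTerm_neg, ← alphad_neg hd hev, ← logTrigMGF_zero_right]
  refine (abs_logTrigMGF_sub_le hd _ _ _ _).trans ?_
  have h1 := abs_coeff_sub_le hj hs
  rw [neg_sub_neg, abs_sub_comm (s / Real.pi / _)]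
  have h2 : |s / ((2 * m + 1 : ℕ) : ℝ) - 0| = s / (2 * m + 1 : ℕ) := by
    rw [sub_zero, abs_of_nonneg (by positivity)]
  linarith

lemma coeff_sq_add_sq_le {m j : ℕ} (hj : j ≤ m) (s : ℝ) :
    (s / (2 * m + 1 : ℕ) * (Real.cos (halfAngle (2 * m + 1) j) /
      Real.sin (halfAngle (2 * m + 1) j))) ^ 2 + (s / (2 * m + 1 : ℕ)) ^ 2 ≤
      s ^ 2 * (1 / (2 * (j : ℝ) + 1) ^ 2) := by
  obtain ⟨h0, h1⟩ := halfAngle_mem hj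
  have hs := sin_halfAngle_pos hj
  have hp : (0 : ℝ) < (2 * m + 1 : ℕ) := by positivity
  have h2 := Real.mul_le_sin h0.le h1
  have h3 : 2 / Real.pi * halfAngle (2 * m + 1) j = (2 * j + 1) / (2 * m + 1 : ℕ) := by
    have := Real.pi_pos
    unfold halfAngle
    rw [Int.cast_natCast]
    field_simp
  rw [h3, div_le_iff₀ hp] at h2
  set S := Real.sin (halfAngle (2 * m + 1) j)
  set P : ℝ := ((2 * m + 1 : ℕ) : ℝ)
  have h4 : (s / P * (Real.cos (halfAngle (2 * m + 1) j) / S)) ^ 2 + (s / P) ^ 2 =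
      s ^ 2 * (1 / (S * P) ^ 2) := by
    have := Real.sin_sq_add_cos_sq (halfAngle (2 * m + 1) j)
    change S ^ 2 + _ = 1 at this
    field_simp
    rw [add_comm, this, mul_one]
  rw [h4]
  gcongr

lemma logLaplaceTerm_le {d m j : ℕ} (hd : 0 < d) (hev : Even d) (hj : j ≤ m) (s : ℝ) :
    logLaplaceTerm (2 * m + 1) d s j ≤ s ^ 2 * (1 / (2 * (j : ℝ) + 1) ^ 2) / 2 := by
  refine (logTrigMGF_le_half_sq hd hev _ _).trans ?_
  have := coeff_sq_add_sq_le hj s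
  gcongr

lemma logLaplaceTerm_neg_le {d m j : ℕ} (hd : 0 < d) (hev : Even d) (hj : j ≤ m) (s : ℝ) :
    logLaplaceTerm (2 * m + 1) d s (-((j : ℤ) + 1)) ≤
      s ^ 2 * (1 / (2 * (j : ℝ) + 1) ^ 2) / 2 := by
  rw [logLaplaceTerm_neg]
  refine (logTrigMGF_le_half_sq hd hev _ _).trans ?_
  rw [neg_sq]
  have := coeff_sq_add_sq_le hj s
  gcongr

lemma sum_Ico_inv_odd_sq_le {n m : ℕ} (hn : 0 < n) (hnm : n ≤ m) :
    ∑ j ∈ Finset.Ico n m, 1 / (2 * (j : ℝ) + 1) ^ 2 ≤ 1 / (n : ℝ) - 1 / m := by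
  induction m, hnm using Nat.le_induction with
  | base => simp
  | succ m hnm ih =>
    rw [Finset.sum_Ico_succ_top hnm]
    have hm : (0 : ℝ) < m := by exact_mod_cast hn.trans_le hnm
    have h : 1 / (2 * (m : ℝ) + 1) ^ 2 ≤ 1 / (m : ℝ) - 1 / (m + 1 : ℕ) := by
      push_cast
      rw [div_sub_div _ _ hm.ne' (by positivity), div_le_div_iff₀ (by positivity) (by positivity)]
      nlinarith
    linarith

lemma abs_sum_logLaplaceTerm_sub_le {d m n : ℕ} (hd : 0 < d) (hev : Even d) {s : ℝ} (hs : 0 < s)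
    (hn : s ^ 2 ≤ n) (hnm : n ≤ m) :
    |∑ j ∈ Jhalf (2 * m + 1), logLaplaceTerm (2 * m + 1) d s j -
      2 * ∑ j ∈ Finset.range n, alphad d (s / Real.pi / (j + 1 / 2))| ≤
      n * (4 * (s / (2 * m + 1 : ℕ))) + 2 := by
  set F := logLaplaceTerm (2 * m + 1) d s with hF
  have hn0 : 0 < n := by
    have : (0 : ℝ) < n := (pow_pos hs 2).trans_le hn
    exact_mod_cast this
  have hn0' : (0 : ℝ) < n := by exact_mod_cast hn0
  have hF0 : ∀ j, 0 ≤ F j := fun j => logTrigMGF_nonneg hd hev _ _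
  have hhead : |∑ j ∈ Finset.range n, (F j + F (-((j : ℤ) + 1))) -
      2 * ∑ j ∈ Finset.range n, alphad d (s / Real.pi / (j + 1 / 2))| ≤
      n * (4 * (s / (2 * m + 1 : ℕ))) := by
    rw [Finset.mul_sum, ← Finset.sum_sub_distrib]
    refine (Finset.abs_sum_le_sum_abs _ _).trans ?_
    calc _ ≤ ∑ j ∈ Finset.range n, 4 * (s / ((2 * m + 1 : ℕ) : ℝ)) := by
          refine Finset.sum_le_sum fun j hj => ?_
          have hjm : j ≤ m := (Finset.mem_range.1 hj).le.trans hnm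
          have h1 := abs_le.1 (abs_logLaplaceTerm_sub_le hd hjm hs.le)
          have h2 := abs_le.1 (abs_logLaplaceTerm_neg_sub_le hd hev hjm hs.le)
          rw [abs_le]
          constructor <;> linarith [h1.1, h1.2, h2.1, h2.2]
      _ = _ := by simp
  have htail : ∑ j ∈ Finset.Ico n m, (F j + F (-((j : ℤ) + 1))) ≤ 1 := by
    calc _ ≤ ∑ j ∈ Finset.Ico n m, s ^ 2 * (1 / (2 * (j : ℝ) + 1) ^ 2) := by
          refine Finset.sum_le_sum fun j hj => ?_
          have hjm : j ≤ m := (Finset.mem_Ico.1 hj).2.le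
          have h1 := logLaplaceTerm_le hd hev hjm s
          have h2 := logLaplaceTerm_neg_le hd hev hjm s
          linarith
      _ = s ^ 2 * ∑ j ∈ Finset.Ico n m, 1 / (2 * (j : ℝ) + 1) ^ 2 := by rw [Finset.mul_sum]
      _ ≤ s ^ 2 * (1 / n) := by
          have h1 := sum_Ico_inv_odd_sq_le hn0 hnm
          have h2 : (0 : ℝ) ≤ 1 / m := by positivity
          gcongr
          linarith
      _ ≤ 1 := by rwa [mul_one_div, div_le_one hn0']
  have htail0 : 0 ≤ ∑ j ∈ Finset.Ico n m, (F j + F (-((j : ℤ) + 1))) :=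
    Finset.sum_nonneg fun j _ => add_nonneg (hF0 _) (hF0 _)
  have hlast : F m ≤ 1 := by
    refine (logLaplaceTerm_le hd hev le_rfl s).trans ?_
    have hnm' : (n : ℝ) ≤ m := by exact_mod_cast hnm
    have h1 : s ^ 2 * (1 / (2 * (m : ℝ) + 1) ^ 2) ≤ 1 := by
      rw [mul_one_div, div_le_one (by positivity)]
      nlinarith
    linarith
  have h1 := abs_le.1 hhead
  rw [sum_Jhalf_eq, Finset.range_eq_Ico, ← Finset.sum_Ico_consecutive _ (Nat.zero_le n) hnm,
    ← Finset.range_eq_Ico]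
  rw [abs_le]
  constructor <;> linarith [hF0 m, h1.1, h1.2]

lemma abs_log_expectR_sub_le {p d : ℕ} (hodd : Odd p) (hd : 0 < d) (hev : Even d) {s : ℝ}
    (hs : 2 ≤ s) (hsp : 8 * s ^ 3 ≤ p) :
    |Real.log (expectR (fun ω : {j : ℤ // j ∈ Jhalf p} → Fin d =>
        Real.exp (2 * s * (GX p d ω).re))) -
      (2 * s / Real.pi * Real.log s + Cd d * s)| ≤
      4 * Real.log s + (8 * Real.log (2 * Real.pi) + 23) := by
  obtain ⟨m, rfl⟩ := hodd
  rw [log_expectR_eq hd s fun j hj => sin_halfAngle_ne_zero hj]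
  set n := ⌈s ^ 2⌉₊ with hn
  have h1 : s ^ 2 ≤ n := Nat.le_ceil _
  have h2 : (n : ℝ) < s ^ 2 + 1 := Nat.ceil_lt_add_one (sq_nonneg s)
  have hnm : n ≤ m := by
    have : (n : ℝ) ≤ m := by
      push_cast at hsp
      nlinarith
    exact_mod_cast this
  have h3 := abs_le.1 (abs_sum_logLaplaceTerm_sub_le hd hev (by linarith) h1 hnm)
  have h4 := abs_le.1 (abs_sum_alphad_sub_le hd hev hs h1)
  have h5 : n * (4 * (s / ((2 * m + 1 : ℕ) : ℝ))) ≤ 1 := by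
    rw [show n * (4 * (s / ((2 * m + 1 : ℕ) : ℝ))) = 4 * n * s / ((2 * m + 1 : ℕ) : ℝ) by ring,
      div_le_one (by positivity)]
    nlinarith
  have h6 : 2 * s / Real.pi * Real.log s = 2 * (s / Real.pi * Real.log s) := by ring
  rw [abs_le]
  constructor <;> linarith [h3.1, h3.2, h4.1, h4.2]

open Filter in
lemma eventually_log_conditions :
    ∀ᶠ p : ℕ in atTop, 1 ≤ Real.log (Real.log (Real.log p)) ∧ 0 ≤ Real.log p ∧
      8 * Real.log p ^ 3 ≤ p := by
  have hcast := tendsto_natCast_atTop_atTop (R := ℝ)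
  have hlog := Real.tendsto_log_atTop
  have h1 := (hlog.comp (hlog.comp (hlog.comp hcast))).eventually_ge_atTop 1
  have h2 := (hlog.comp hcast).eventually_ge_atTop 0
  have h3 := hcast.eventually ((Real.isLittleO_pow_log_id_atTop (n := 3)).bound
    (show (0 : ℝ) < 1 / 8 by norm_num))
  filter_upwards [h1, h2, h3] with p h1 h2 h3
  refine ⟨h1, h2, ?_⟩
  have h4 : (0 : ℝ) ≤ p := Nat.cast_nonneg p
  have h2' : 0 ≤ Real.log p := h2
  rw [id, Real.norm_of_nonneg (by positivity), Real.norm_of_nonneg h4] at h3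
  linarith

/-- Proposition 5.3: for even `d` and `2 ≤ s ≤ (log p)/(log log log p)`,
`log E(exp(2s Re G_{X,χ})) = (2s/π) log s + C_d s + O(log s)`. -/
theorem log_laplace_transform_estimate :
    ∃ C > 0, ∃ p₀ : ℕ, ∀ (p : ℕ) [Fact p.Prime], p₀ ≤ p →
      ∀ d : ℕ, 2 ≤ d → Even d →
      ∀ χ : DirichletCharacter ℂ p, orderOf χ = d →
      ∀ s : ℝ, 2 ≤ s → s ≤ Real.log p / Real.log (Real.log (Real.log p)) →
        |Real.log (expectR (fun ω : {j : ℤ // j ∈ Jhalf p} → Fin d =>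
              Real.exp (2 * s * (GX p d ω).re)))
            - (2 * s / Real.pi * Real.log s + Cd d * s)|
          ≤ C * Real.log s := by
  obtain ⟨p₀, hp₀⟩ := Filter.eventually_atTop.1 eventually_log_conditions
  have hlog2 : 0 < Real.log 2 := Real.log_pos one_lt_two
  have hK : 0 < 8 * Real.log (2 * Real.pi) + 23 := by linarith [log_two_mul_pi_pos]
  refine ⟨4 + (8 * Real.log (2 * Real.pi) + 23) / Real.log 2, by positivity, max p₀ 3, ?_⟩
  intro p hp hle d hd hev χ _ s hs hsp
  obtain ⟨h1, h2, h3⟩ := hp₀ p ((le_max_left _ _).trans hle)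
  have hp3 : 3 ≤ p := (le_max_right _ _).trans hle
  have hodd : Odd p := hp.out.odd_of_ne_two (by omega)
  have hs' : s ≤ Real.log p := hsp.trans (div_le_self h2 h1)
  have h4 : 8 * s ^ 3 ≤ p := le_trans (by gcongr) h3
  refine (abs_log_expectR_sub_le hodd (by omega) hev hs h4).trans ?_
  have h5 : Real.log 2 ≤ Real.log s := Real.log_le_log two_pos hs
  have h6 : 8 * Real.log (2 * Real.pi) + 23 ≤
      (8 * Real.log (2 * Real.pi) + 23) / Real.log 2 * Real.log s := by
    rw [div_mul_eq_mul_div, le_div_iff₀ hlog2]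
    gcongr
  linarith

end
end
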